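/- Assume N = 3. Let a ∈ S_{Id} and let a* ∈ S_{Id} be proper to a, i.e. t_{a*} I t_{a*}^{-1} ∩ K ⊆ t_a I t_a^{-1} ∩ K. Then there exist a finite index set J and, for each j ∈ J, a scalar c_j ∈ \bar{𝔽}_p, an element ν_j ∈ W(χ_σ) and a vector b_j ∈ ℤ², such that Σ_{j∈J} c_j · (f_{Id,a}|T_{ν_j t_{b_j}}) = f_{Id,a*}. -/

import Mathlib

open Matrix

noncomputable section

namespace IH

variable (p : ℕ) [Fact p.Prime]

/-- `\bar{𝔽}_p`, an algebraic closure of the residue field. -/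
abbrev kb := AlgebraicClosure (ZMod p)

variable (N : ℕ)

/-- `G = GL_N(F)` with `F = ℚ_p`. -/
abbrev GG := GL (Fin N) ℚ_[p]
/-- `GL_N(O_F)` (as an abstract group, mapping onto `K ⊆ G`). -/
abbrev MM := GL (Fin N) ℤ_[p]
/-- `GL_N(k_F)`. -/
abbrev Gk := GL (Fin N) (ZMod p)

/-- The inclusion `GL_N(O_F) → GL_N(F)`. -/
def iotaM : MM p N →* GG p N := Matrix.GeneralLinearGroup.map (PadicInt.Coe.ringHom)

/-- The reduction map `red : GL_N(O_F) → GL_N(k_F)`. -/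
def redM : MM p N →* Gk p N := Matrix.GeneralLinearGroup.map (PadicInt.toZMod)

/-- Elements of `GL_N(O_F)` whose reduction is upper triangular: the Iwahori condition. -/
def Ipre : Set (MM p N) :=
  {m | ∀ i j : Fin N, j < i → ((redM p N m : Matrix (Fin N) (Fin N) (ZMod p)) i j = 0)}

/-- Elements of `GL_N(O_F)` whose reduction is upper triangular unipotent: pro-p Iwahori. -/
def I1pre : Set (MM p N) :=
  {m | m ∈ Ipre p N ∧ ∀ i : Fin N, ((redM p N m : Matrix (Fin N) (Fin N) (ZMod p)) i i = 1)}

/-- Elements of `GL_N(O_F)` reducing to the identity: `K_1 = ker red`. -/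
def K1pre : Set (MM p N) := {m | redM p N m = 1}

/-- `K = GL_N(O_F)` as a subset of `G`. -/
def Kset : Set (GG p N) := Set.range (iotaM p N)
/-- The Iwahori subgroup `I ⊆ G`. -/
def Iset : Set (GG p N) := iotaM p N '' Ipre p N
/-- The pro-p Iwahori subgroup `I_1 ⊆ G`. -/
def I1set : Set (GG p N) := iotaM p N '' I1pre p N
/-- `K_1 ⊆ G`. -/
def K1set : Set (GG p N) := iotaM p N '' K1pre p N

/-- The uniformizer `ϖ = p` as a unit of `ℚ_p`. -/
def pU : ℚ_[p]ˣ :=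
  Units.mk0 (p : ℚ_[p]) (by
    have h := (Fact.out : p.Prime).ne_zero
    exact_mod_cast Nat.cast_ne_zero.mpr h)

/-- Scalar matrices as elements of `G`. -/
def scalarGL (u : ℚ_[p]ˣ) : GG p N :=
  Units.map (algebraMap ℚ_[p] (Matrix (Fin N) (Fin N) ℚ_[p])).toMonoidHom u

/-- The central element `ϖ^n · Id`. -/
def piSc (n : ℤ) : GG p N := scalarGL p N (pU p ^ n)

/-- Invertible diagonal matrices. -/
def diagGL (d : Fin N → ℚ_[p]ˣ) : GG p N where
  val := Matrix.diagonal fun i => (d i : ℚ_[p])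
  inv := Matrix.diagonal fun i => (((d i)⁻¹ : ℚ_[p]ˣ) : ℚ_[p])
  val_inv := by
    rw [Matrix.diagonal_mul_diagonal]
    simp
  inv_val := by
    rw [Matrix.diagonal_mul_diagonal]
    simp

/-- extend `a ∈ ℤ^{N-1}` by `0` in the last coordinate. -/
def expo (a : Fin (N - 1) → ℤ) : Fin N → ℤ :=
  fun i => if h : (i : ℕ) < N - 1 then a ⟨i, h⟩ else 0

/-- `t_a = diag(ϖ^{a_1}, …, ϖ^{a_{N-1}}, 1)`. -/
def tGL (a : Fin (N - 1) → ℤ) : GG p N :=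
  diagGL p N fun i => pU p ^ (expo N a i)

/-- The permutation matrix of `σ` (with `permGL σ · e_j = e_{σ j}`, so that
`permGL` is a group homomorphism). -/
def permGL (σ : Equiv.Perm (Fin N)) : GG p N where
  val := (σ⁻¹).permMatrix ℚ_[p]
  inv := σ.permMatrix ℚ_[p]
  val_inv := by
    show ((σ⁻¹).toPEquiv.toMatrix : Matrix (Fin N) (Fin N) ℚ_[p]) * σ.toPEquiv.toMatrix = 1
    rw [← PEquiv.toMatrix_trans, ← Equiv.toPEquiv_trans]
    simp only [Equiv.self_trans_symm, Equiv.symm_trans_self, Equiv.Perm.inv_def]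
    rw [Equiv.toPEquiv_refl, PEquiv.toMatrix_refl]
  inv_val := by
    show (σ.toPEquiv.toMatrix : Matrix (Fin N) (Fin N) ℚ_[p]) * (σ⁻¹).toPEquiv.toMatrix = 1
    rw [← PEquiv.toMatrix_trans, ← Equiv.toPEquiv_trans]
    simp only [Equiv.self_trans_symm, Equiv.symm_trans_self, Equiv.Perm.inv_def]
    rw [Equiv.toPEquiv_refl, PEquiv.toMatrix_refl]

/-- `ω t_a`. -/
def wS (σ : Equiv.Perm (Fin N)) (a : Fin (N - 1) → ℤ) : GG p N :=
  permGL p N σ * tGL p N a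

/-- The permutation `ω₂` (as a matrix: first row block `(0, I_{N-1})`, last row `(1,0,…,0)`). -/
def w2 : Equiv.Perm (Fin N) := (finRotate N)⁻¹

/-- `γ = ω₂ · diag(ϖ, I_{N-1})`. -/
def gammaGL : GG p N :=
  permGL p N (w2 N) * tGL p N fun i => if (i : ℕ) = 0 then 1 else 0

/-- `S_ω = {a ∈ ℤ^{N-1} : (ω t_a) I (ω t_a)⁻¹ ∩ K ⊆ I}`. -/
def Sset (σ : Equiv.Perm (Fin N)) : Set (Fin (N - 1) → ℤ) :=
  {a | ∀ g ∈ Iset p N,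
    wS p N σ a * g * (wS p N σ a)⁻¹ ∈ Kset p N →
    wS p N σ a * g * (wS p N σ a)⁻¹ ∈ Iset p N}

/-- The unit of `k_F^×` attached to a nonzero element of `k_F` (junk value `1` at `0`). -/
def unitOf (x : ZMod p) : (ZMod p)ˣ :=
  if h : x = 0 then 1 else Units.mk0 x h

/-- The diagonal of the reduction of `m`, as an `N`-tuple of units of `k_F`. -/
def diagOf (m : MM p N) : Fin N → (ZMod p)ˣ :=
  fun i => unitOf p ((redM p N m : Matrix (Fin N) (Fin N) (ZMod p)) i i)

/-- The transformation rule for functions in `H_{IZ}(χ)`, where the character `χ` of `I`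
is given by the character `ξ` of the torus `(k_F^×)^N` through the diagonal of the
reduction, extended to `IZ` by `χ(ϖ) = 1`. -/
def HTransf (ξ : (Fin N → (ZMod p)ˣ) →* (kb p)ˣ) (φ : GG p N → kb p) : Prop :=
  ∀ (n₁ n₂ : ℤ) (m₁ m₂ : MM p N), m₁ ∈ Ipre p N → m₂ ∈ Ipre p N → ∀ g : GG p N,
    φ (piSc p N n₁ * iotaM p N m₁ * g * (piSc p N n₂ * iotaM p N m₂)) =
      (ξ (diagOf p N m₁) : kb p) * (ξ (diagOf p N m₂) : kb p) * φ g

/-- `φ` is supported on the double coset `IZ x I`. -/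
def SuppDouble (φ : GG p N → kb p) (x : GG p N) : Prop :=
  ∀ g : GG p N, φ g ≠ 0 → ∃ (n : ℤ) (m₁ m₂ : MM p N), m₁ ∈ Ipre p N ∧ m₂ ∈ Ipre p N ∧
    g = piSc p N n * iotaM p N m₁ * x * iotaM p N m₂

/-- Membership in `H_{IZ}(χ)`: the transformation rule together with support in
finitely many double cosets `IZ g I`. -/
def HMem (ξ : (Fin N → (ZMod p)ˣ) →* (kb p)ˣ) (φ : GG p N → kb p) : Prop :=
  HTransf p N ξ φ ∧
  ∃ S : Finset (GG p N), ∀ g : GG p N, φ g ≠ 0 →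
    ∃ s ∈ S, ∃ (n : ℤ) (m₁ m₂ : MM p N), m₁ ∈ Ipre p N ∧ m₂ ∈ Ipre p N ∧
      g = piSc p N n * iotaM p N m₁ * s * iotaM p N m₂

section Rep

variable {V : Type} [AddCommGroup V] [Module (kb p) V]

/-- `σ` (here `ρ`) is irreducible. -/
def IsIrred (ρ : Representation (kb p) (Gk p N) V) : Prop :=
  (∃ v : V, v ≠ 0) ∧
  ∀ W : Submodule (kb p) V, (∀ g v, v ∈ W → ρ g v ∈ W) → W = ⊥ ∨ W = ⊤

/-- Membership in the compact induction `ind_{KZ}^G σ`: left `KZ`-equivariance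
(where `ϖ` acts trivially), support in finitely many cosets `KZ g`, and smoothness. -/
def IndMem (ρ : Representation (kb p) (Gk p N) V) (f : GG p N → V) : Prop :=
  (∀ (n : ℤ) (m : MM p N) (g : GG p N),
      f (piSc p N n * iotaM p N m * g) = ρ (redM p N m) (f g)) ∧
  (∃ S : Finset (GG p N), ∀ g : GG p N, f g ≠ 0 →
      ∃ s ∈ S, ∃ (n : ℤ) (m : MM p N), g = piSc p N n * iotaM p N m * s) ∧
  (∃ U : Subgroup (GG p N), IsOpen (U : Set (GG p N)) ∧ ∀ u ∈ U, ∀ g, f (g * u) = f g)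

/-- `f` is invariant under right translation by `I_1`. -/
def IsI1Inv (f : GG p N → V) : Prop :=
  ∀ u ∈ I1set p N, ∀ g, f (g * u) = f g

/-- The defining property of the standard function `f_{ω,a}`: an `I_1`-invariant member of
`ind_{KZ}^G σ` supported on `KZ t_a I_1` with value `v₀` at `ω t_a`. -/
def IsStd (ρ : Representation (kb p) (Gk p N) V) (v₀ : V)
    (σp : Equiv.Perm (Fin N)) (a : Fin (N - 1) → ℤ) (f : GG p N → V) : Prop :=
  IndMem p N ρ f ∧ IsI1Inv p N f ∧
  (∀ g : GG p N, f g ≠ 0 → ∃ (n : ℤ) (m : MM p N) (u : GG p N), u ∈ I1set p N ∧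
      g = piSc p N n * iotaM p N m * tGL p N a * u) ∧
  f (wS p N σp a) = v₀

/-- `R` is a set of representatives for `I_1/(I_1 ∩ g⁻¹ I_1 g)`. -/
def IsRepSet (g : GG p N) (R : Finset (GG p N)) : Prop :=
  (↑R ⊆ I1set p N) ∧
  ∀ x ∈ I1set p N, ∃! r : GG p N, r ∈ R ∧
    (r⁻¹ * x ∈ I1set p N ∧ g * (r⁻¹ * x) * g⁻¹ ∈ I1set p N)

/-- The Hecke operator: `f|T_g = ∑_{r} (r g⁻¹)·f`, where `(h·f)(x) = f(xh)`. -/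
def hk (g : GG p N) (R : Finset (GG p N)) (f : GG p N → V) : GG p N → V :=
  fun x => ∑ r ∈ R, f (x * r * g⁻¹)

end Rep


section Unitriangular

variable {R : Type*} [CommRing R] {n : ℕ}

/-- The group of upper triangular unipotent matrices. -/
def unitriangular (R : Type*) [CommRing R] (n : ℕ) : Subgroup (GL (Fin n) R) where
  carrier := {g | g.val.BlockTriangular id ∧ ∀ i, g i i = 1}
  one_mem' := ⟨Matrix.blockTriangular_one, fun i => by simp⟩
  mul_mem' := by
    rintro g h ⟨hg, hg1⟩ ⟨hh, hh1⟩
    refine ⟨hg.mul hh, fun i => ?_⟩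
    rw [Units.val_mul, Matrix.mul_apply, Finset.sum_eq_single i]
    · rw [hg1, hh1, one_mul]
    · intro j _ hj
      rcases lt_or_gt_of_ne hj with hlt | hlt
      · rw [hg hlt, zero_mul]
      · rw [hh hlt, mul_zero]
    · simp
  inv_mem' := by
    rintro g ⟨hg, hg1⟩
    have hinv : (g⁻¹).val.BlockTriangular id := by
      rw [Matrix.coe_units_inv]
      have : Invertible g.val := g.isUnit.invertible
      exact Matrix.blockTriangular_inv_of_blockTriangular hg
    refine ⟨hinv, fun i => ?_⟩
    have h : (g.val * (g⁻¹).val) i i = 1 := by simp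
    rw [Matrix.mul_apply, Finset.sum_eq_single i, hg1, one_mul] at h
    · exact h
    · intro j _ hj
      rcases lt_or_gt_of_ne hj with hlt | hlt
      · rw [hg hlt, zero_mul]
      · rw [hinv hlt, mul_zero]
    · simp

theorem det_eq_one_of_mem_unitriangular {g : GL (Fin n) R} (hg : g ∈ unitriangular R n) :
    g.val.det = 1 := by
  rw [Matrix.det_of_isUpperTriangular hg.1]
  exact Finset.prod_eq_one fun i _ => hg.2 i

theorem map_mem_unitriangular {S : Type*} [CommRing S] (φ : R →+* S) {g : GL (Fin n) R}
    (hg : g ∈ unitriangular R n) :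
    Matrix.GeneralLinearGroup.map φ g ∈ unitriangular S n := by
  refine ⟨fun i j hij => ?_, fun i => ?_⟩
  · simpa using congrArg φ (hg.1 hij)
  · simpa using congrArg φ (hg.2 i)

/-- The elementary matrix `1 + c E_{ij}` as an invertible matrix. -/
def elemGL {i j : Fin n} (hij : i ≠ j) (c : R) : GL (Fin n) R :=
  Matrix.GeneralLinearGroup.mk'' (Matrix.transvection i j c)
    (by rw [Matrix.det_transvection_of_ne i j hij]; exact isUnit_one)

theorem elemGL_apply {i j : Fin n} (hij : i ≠ j) (c : R) (k l : Fin n) :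
    elemGL hij c k l = (1 : Matrix (Fin n) (Fin n) R) k l + Matrix.single i j c k l :=
  rfl

end Unitriangular

section Iwahori

variable {p : ℕ} [Fact p.Prime] {N : ℕ}

@[simp]
theorem iotaM_apply (m : MM p N) (i j : Fin N) : iotaM p N m i j = ((m i j : ℤ_[p]) : ℚ_[p]) :=
  rfl

@[simp]
theorem redM_apply (m : MM p N) (i j : Fin N) : redM p N m i j = PadicInt.toZMod (m i j) :=
  rfl

theorem iotaM_injective : Function.Injective (iotaM p N) := by
  intro m m' h
  ext i j
  have := congrArg (fun g : GG p N => g i j) h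
  exact PadicInt.ext this

theorem mem_I1pre_iff {m : MM p N} : m ∈ I1pre p N ↔ redM p N m ∈ unitriangular (ZMod p) N :=
  ⟨fun h => ⟨fun i j hij => h.1 i j hij, h.2⟩, fun h => ⟨fun _ _ hij => h.1 hij, h.2⟩⟩

variable (p N) in
/-- The pro-p Iwahori subgroup as a subgroup of `G`. -/
def I1sub : Subgroup (GG p N) := ((unitriangular (ZMod p) N).comap (redM p N)).map (iotaM p N)

theorem mem_I1set_iff {g : GG p N} : g ∈ I1set p N ↔ g ∈ I1sub p N := by
  simp only [I1set, I1sub, Set.mem_image, mem_I1pre_iff, Subgroup.mem_map, Subgroup.mem_comap]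

theorem iotaM_mem_I1sub {m : MM p N} (hm : m ∈ I1pre p N) : iotaM p N m ∈ I1sub p N :=
  mem_I1set_iff.1 ⟨m, hm, rfl⟩

theorem mem_I1pre_of_mem_unitriangular {m : MM p N} (hm : m ∈ unitriangular ℤ_[p] N) :
    m ∈ I1pre p N :=
  mem_I1pre_iff.2 (map_mem_unitriangular _ hm)

theorem mem_unitriangular_of_iotaM_mem {m : MM p N}
    (hm : iotaM p N m ∈ unitriangular ℚ_[p] N) : m ∈ unitriangular ℤ_[p] N := by
  refine ⟨fun i j hij => ?_, fun i => ?_⟩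
  · exact PadicInt.ext (hm.1 hij)
  · exact PadicInt.ext (hm.2 i)

theorem piSc_mul_comm (n : ℤ) (g : GG p N) : piSc p N n * g = g * piSc p N n := by
  apply Units.ext
  exact Algebra.commutes _ _

theorem piSc_zero : piSc p N 0 = 1 := by
  simp [piSc, scalarGL]

/-- The diagonal matrix with entries `ϖ^{e i}`. -/
def powDiag (p : ℕ) [Fact p.Prime] {N : ℕ} (e : Fin N → ℤ) : GG p N :=
  diagGL p N fun i => pU p ^ e i

theorem powDiag_add (e e' : Fin N → ℤ) : powDiag p (e + e') = powDiag p e * powDiag p e' := by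
  apply Units.ext
  simp [powDiag, diagGL, Matrix.diagonal_mul_diagonal, zpow_add₀ (pU p).ne_zero]

theorem powDiag_neg (e : Fin N → ℤ) : powDiag p (-e) = (powDiag p e)⁻¹ := by
  rw [eq_inv_iff_mul_eq_one, ← powDiag_add]
  apply Units.ext
  simp [powDiag, diagGL]

theorem natCast_p_ne_zero : (p : ℚ_[p]) ≠ 0 := (pU p).ne_zero

theorem powDiag_conj_apply (e : Fin N → ℤ) (g : GG p N) (i j : Fin N) :
    (powDiag p e * g * (powDiag p e)⁻¹) i j = (p : ℚ_[p]) ^ (e i - e j) * g i j := by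
  rw [← powDiag_neg]
  simp only [powDiag, diagGL, Units.val_mul, Matrix.mul_diagonal, Matrix.diagonal_mul]
  simp only [pU, Pi.neg_apply, Units.val_zpow_eq_zpow_val, Units.val_mk0]
  rw [_root_.zpow_neg, zpow_sub₀ natCast_p_ne_zero]
  ring

theorem powDiag_conj_mem_unitriangular (e : Fin N → ℤ) {g : GG p N}
    (hg : g ∈ unitriangular ℚ_[p] N) :
    powDiag p e * g * (powDiag p e)⁻¹ ∈ unitriangular ℚ_[p] N := by
  refine ⟨fun i j hij => ?_, fun i => ?_⟩
  · rw [powDiag_conj_apply, hg.1 hij, mul_zero]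
  · rw [powDiag_conj_apply, hg.2 i, sub_self, zpow_zero, one_mul]

/-- Conjugation by a diagonal matrix preserves `I_1` on elements whose nonzero entries
are only multiplied by nonnegative powers of `ϖ`. -/
theorem exists_powDiag_conj_eq (e : Fin N → ℤ) {m : MM p N} (hm : m ∈ I1pre p N)
    (h : ∀ i j, m i j = 0 ∨ e j ≤ e i) :
    ∃ m' ∈ I1pre p N, powDiag p e * iotaM p N m * (powDiag p e)⁻¹ = iotaM p N m' := by
  set A : Matrix (Fin N) (Fin N) ℤ_[p] :=
    Matrix.of fun i j => (p : ℤ_[p]) ^ (e i - e j).toNat * m i j with hA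
  have key : A.map PadicInt.Coe.ringHom = (powDiag p e * iotaM p N m * (powDiag p e)⁻¹).val := by
    ext i j
    rw [powDiag_conj_apply, iotaM_apply, Matrix.map_apply, hA, Matrix.of_apply]
    rcases h i j with h0 | hle
    · simp [h0]
    · rw [map_mul, map_pow, map_natCast, ← zpow_natCast, Int.toNat_of_nonneg (by lia)]
      rfl
  have hdet : A.det = m.val.det := by
    apply PadicInt.ext
    change PadicInt.Coe.ringHom A.det = PadicInt.Coe.ringHom m.val.det
    rw [RingHom.map_det, RingHom.map_det]
    change (A.map PadicInt.Coe.ringHom).det = (iotaM p N m).val.det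
    rw [key, Units.val_mul, Units.val_mul, Matrix.det_units_conj]
  refine ⟨Matrix.GeneralLinearGroup.mk'' A (hdet ▸ (Matrix.isUnit_iff_isUnit_det _).1 m.isUnit),
    ?_, Units.ext key.symm⟩
  refine ⟨fun i j hij => ?_, fun i => ?_⟩
  · change PadicInt.toZMod ((p : ℤ_[p]) ^ (e i - e j).toNat * m i j) = 0
    have := hm.1 i j hij
    rw [redM_apply] at this
    rw [map_mul, this, mul_zero]
  · change PadicInt.toZMod ((p : ℤ_[p]) ^ (e i - e i).toNat * m i i) = 1
    have := hm.2 i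
    rw [redM_apply] at this
    rw [map_mul, this, sub_self]
    simp

theorem norm_det_iotaM (m : MM p N) : ‖(iotaM p N m).val.det‖ = 1 := by
  have : (iotaM p N m).val.det = ((m.val.det : ℤ_[p]) : ℚ_[p]) :=
    (RingHom.map_det PadicInt.Coe.ringHom m.val).symm
  rw [this, ← PadicInt.norm_def]
  exact PadicInt.isUnit_iff.1 ((Matrix.isUnit_iff_isUnit_det _).1 m.isUnit)

/-- A unipotent element of `ZK` lies in `K`. -/
theorem eq_zero_of_piSc_mul_mem_unitriangular [NeZero N] {n : ℤ} {m : MM p N}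
    (h : piSc p N n * iotaM p N m ∈ unitriangular ℚ_[p] N) : n = 0 := by
  have hd := det_eq_one_of_mem_unitriangular h
  have hs : (piSc p N n).val.det = ((p : ℚ_[p]) ^ n) ^ N := by
    change (algebraMap ℚ_[p] (Matrix (Fin N) (Fin N) ℚ_[p]) ((pU p ^ n : ℚ_[p]ˣ) : ℚ_[p])).det = _
    rw [Matrix.algebraMap_eq_diagonal, Matrix.det_diagonal]
    simp [pU]
  have hn := congrArg norm hd
  rw [Units.val_mul, Matrix.det_mul, norm_mul, norm_det_iotaM, hs, norm_pow, mul_one, norm_one,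
    pow_eq_one_iff_of_nonneg (norm_nonneg _) (NeZero.ne N), Padic.norm_p_zpow] at hn
  have hp : (1 : ℝ) < p := by exact_mod_cast (Fact.out : p.Prime).one_lt
  have := (zpow_eq_one_iff_right₀ (by positivity) hp.ne').1 hn
  lia

theorem isUnit_of_toZMod_eq_one {x : ℤ_[p]} (hx : PadicInt.toZMod x = 1) : IsUnit x := by
  by_contra h
  have : x ∈ RingHom.ker (PadicInt.toZMod (p := p)) := by
    rw [PadicInt.ker_toZMod]
    exact (IsLocalRing.mem_maximalIdeal x).2 h
  rw [RingHom.mem_ker, hx] at this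
  exact one_ne_zero this

/-- The Iwahori decomposition of the pro-p Iwahori subgroup of `GL_3`. -/
theorem exists_lower_mul_unitriangular {m : MM p 3} (hm : m ∈ I1pre p 3) :
    ∃ l ∈ I1pre p 3, ∃ u ∈ unitriangular ℤ_[p] 3, m = l * u ∧ ∀ i j, i < j → l i j = 0 := by
  have hd (i) : PadicInt.toZMod (m i i) = 1 := hm.2 i
  have h10 : PadicInt.toZMod (m 1 0) = 0 := hm.1 1 0 (by decide)
  obtain ⟨α, hα⟩ := (isUnit_of_toZMod_eq_one (hd 0)).exists_right_inv
  obtain ⟨δ, hδ⟩ := (isUnit_of_toZMod_eq_one (x := m 0 0 * m 1 1 - m 0 1 * m 1 0)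
    (by simp [hd, h10])).exists_right_inv
  set x := -α * m 0 1 with hx
  set y := (m 0 1 * m 1 2 - m 1 1 * m 0 2) * δ with hy
  set z := (m 1 0 * m 0 2 - m 0 0 * m 1 2) * δ with hz
  set v : MM p 3 := Matrix.GeneralLinearGroup.mk'' !![1, x, y; 0, 1, z; 0, 0, 1]
    (by simp [Matrix.det_fin_three]) with hv
  have hvval : v.val = !![1, x, y; 0, 1, z; 0, 0, 1] := rfl
  have hvu : v ∈ unitriangular ℤ_[p] 3 := by
    refine ⟨fun i j hij => ?_, fun i => ?_⟩
    · rw [hvval]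
      fin_cases i <;> fin_cases j <;> simp_all
    · rw [hvval]
      fin_cases i <;> simp
  refine ⟨m * v, ?_, v⁻¹, inv_mem hvu, by simp, fun i j hij => ?_⟩
  · rw [mem_I1pre_iff, map_mul]
    exact mul_mem (mem_I1pre_iff.1 hm) (map_mem_unitriangular _ hvu)
  · rw [Units.val_mul, Matrix.mul_apply, Fin.sum_univ_three, hvval]
    fin_cases i <;> fin_cases j <;> simp_all
    · linear_combination (-m 0 1) * hα
    · linear_combination (-m 0 2) * hδ
    · linear_combination (-m 1 2) * hδ

/-- Elements of `I_1` can be moved past antidominant diagonal matrices on both sides. -/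
theorem exists_powDiag_mul_mul_powDiag {e d : Fin 3 → ℤ} (he : Monotone e) (hd : Monotone d)
    {u : GG p 3} (hu : u ∈ I1sub p 3) :
    ∃ k : MM p 3, ∃ u' ∈ I1sub p 3,
      powDiag p e * u * powDiag p d = iotaM p 3 k * (powDiag p e * powDiag p d) * u' := by
  obtain ⟨m, hm, rfl⟩ := mem_I1set_iff.2 hu
  obtain ⟨l, hl, w, hw, rfl, hl0⟩ := exists_lower_mul_unitriangular hm
  obtain ⟨l', -, hl'⟩ := exists_powDiag_conj_eq e hl fun i j =>
    (lt_or_ge i j).imp (hl0 i j) fun h => he h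
  obtain ⟨w', hw', hww'⟩ := exists_powDiag_conj_eq (-d) (mem_I1pre_of_mem_unitriangular hw)
    fun i j => (lt_or_ge j i).imp (fun h => hw.1 h) fun h => neg_le_neg (hd h)
  refine ⟨l', iotaM p 3 w', iotaM_mem_I1sub hw', ?_⟩
  rw [← hl', ← hww', powDiag_neg, map_mul]
  group

/-- If `t_e w' ∈ KZ t_e I_1` with `w'` an antidominant conjugate of an element of `I_1`,
then `w' ∈ I_1`. -/
theorem powDiag_conj_mem_I1sub {e d : Fin 3 → ℤ} (he : Monotone e) (hd : Monotone d)
    {w u : GG p 3} (hw : w ∈ I1sub p 3) (hu : u ∈ I1sub p 3) {n : ℤ} {k : MM p 3}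
    (h : powDiag p e * (powDiag p d * w * (powDiag p d)⁻¹) =
      piSc p 3 n * iotaM p 3 k * powDiag p e * u) :
    powDiag p d * w * (powDiag p d)⁻¹ ∈ I1sub p 3 := by
  obtain ⟨m, hm, rfl⟩ := mem_I1set_iff.2 hw
  obtain ⟨l, hl, x, hx, rfl, hl0⟩ := exists_lower_mul_unitriangular hm
  obtain ⟨m', hm', rfl⟩ := mem_I1set_iff.2 hu
  obtain ⟨c, hc, y, hy, rfl, hc0⟩ := exists_lower_mul_unitriangular hm'
  obtain ⟨l', hl', hll'⟩ := exists_powDiag_conj_eq d hl fun i j =>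
    (lt_or_ge i j).imp (hl0 i j) fun h => hd h
  obtain ⟨l'', -, hll''⟩ := exists_powDiag_conj_eq (e + d) hl fun i j =>
    (lt_or_ge i j).imp (hl0 i j) fun h => (he.add hd) h
  obtain ⟨c', -, hcc'⟩ := exists_powDiag_conj_eq e hc fun i j =>
    (lt_or_ge i j).imp (hc0 i j) fun h => he h
  have hxU : iotaM p 3 x ∈ unitriangular ℚ_[p] 3 := map_mem_unitriangular _ hx
  have hyU : iotaM p 3 y ∈ unitriangular ℚ_[p] 3 := map_mem_unitriangular _ hy
  have hconj : powDiag p e * (powDiag p d * iotaM p 3 x * (powDiag p d)⁻¹ * (iotaM p 3 y)⁻¹) *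
      (powDiag p e)⁻¹ = piSc p 3 n * iotaM p 3 (l''⁻¹ * k * c') := by
    have hz := piSc_mul_comm n (iotaM p 3 l'')⁻¹
    have h' : powDiag p e * (powDiag p d * iotaM p 3 x * (powDiag p d)⁻¹ * (iotaM p 3 y)⁻¹) *
        (powDiag p e)⁻¹ = (iotaM p 3 l'')⁻¹ * (powDiag p e *
          (powDiag p d * iotaM p 3 (l * x) * (powDiag p d)⁻¹)) *
          (iotaM p 3 y)⁻¹ * (powDiag p e)⁻¹ := by
      rw [← hll'', powDiag_add, map_mul]
      group
    rw [h', h, map_mul (iotaM p 3) c y, map_mul, map_mul, map_inv, ← hcc', ← mul_assoc,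
      ← mul_assoc (piSc p 3 n), ← mul_assoc (piSc p 3 n), hz]
    group
  have hmem := powDiag_conj_mem_unitriangular e
    (mul_mem (powDiag_conj_mem_unitriangular d hxU) (inv_mem hyU))
  rw [hconj] at hmem
  obtain rfl := eq_zero_of_piSc_mul_mem_unitriangular hmem
  rw [piSc_zero, one_mul] at hmem hconj
  have hk := mem_unitriangular_of_iotaM_mem hmem
  obtain ⟨y', hy', hyy'⟩ := exists_powDiag_conj_eq (-e) (mem_I1pre_of_mem_unitriangular hk)
    fun i j => (lt_or_ge j i).imp (fun h => hk.1 h) fun h => neg_le_neg (he h)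
  have hsplit : powDiag p d * iotaM p 3 (l * x) * (powDiag p d)⁻¹ =
      iotaM p 3 l' * iotaM p 3 y' * iotaM p 3 y := by
    rw [← hyy', ← hconj, ← hll', powDiag_neg, map_mul]
    group
  rw [hsplit]
  exact mul_mem (mul_mem (iotaM_mem_I1sub hl') (iotaM_mem_I1sub hy'))
    (iotaM_mem_I1sub (mem_I1pre_of_mem_unitriangular hy))

theorem permGL_one : permGL p N 1 = 1 := by
  apply Units.ext
  simp [permGL]

theorem wS_one (a : Fin (N - 1) → ℤ) : wS p N 1 a = powDiag p (expo N a) := by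
  rw [wS, permGL_one, one_mul]
  rfl

theorem expo_sub (a b : Fin (N - 1) → ℤ) : expo N (a - b) = expo N a - expo N b := by
  ext i
  simp only [expo, Pi.sub_apply]
  split <;> simp

theorem powDiag_conj_elemGL (e : Fin N → ℤ) {i j : Fin N} (hij : i ≠ j) {c c' : ℤ_[p]}
    (h : (p : ℚ_[p]) ^ (e i - e j) * c = c') :
    powDiag p e * iotaM p N (elemGL hij c) * (powDiag p e)⁻¹ = iotaM p N (elemGL hij c') := by
  ext k l
  rw [powDiag_conj_apply, iotaM_apply, iotaM_apply, elemGL_apply, elemGL_apply]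
  by_cases hkl : i = k ∧ j = l
  · obtain ⟨rfl, rfl⟩ := hkl
    simp [Matrix.one_apply_ne hij, h]
  · rw [Matrix.single_apply_of_ne _ _ _ _ _ hkl, Matrix.single_apply_of_ne _ _ _ _ _ hkl]
    by_cases hk : k = l
    · subst hk
      simp
    · simp [Matrix.one_apply_ne hk]

theorem elemGL_pow_mem_Ipre {i j : Fin N} (hij : i ≠ j) {n : ℕ} (hn : n ≠ 0) :
    elemGL hij ((p : ℤ_[p]) ^ n) ∈ Ipre p N := by
  intro k l hlk
  rw [redM_apply, elemGL_apply, Matrix.one_apply_ne hlk.ne', zero_add]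
  simp only [Matrix.single_apply]
  split <;> simp [hn]

theorem monotone_expo_of_mem_Sset {a : Fin (N - 1) → ℤ} (ha : a ∈ Sset p N 1) :
    Monotone (expo N a) := by
  refine monotone_iff_forall_lt.2 fun j i hji => ?_
  by_contra! hlt
  have hconj := powDiag_conj_elemGL (p := p) (expo N a) hji.ne'
    (c := (p : ℤ_[p]) ^ (expo N a j - expo N a i).toNat) (c' := 1) (by
      rw [PadicInt.coe_pow, PadicInt.coe_natCast, ← zpow_natCast, Int.toNat_of_nonneg (by lia),
        ← zpow_add₀ natCast_p_ne_zero]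
      simp)
  have hpos : (expo N a j - expo N a i).toNat ≠ 0 := by lia
  have h := ha _ ⟨_, elemGL_pow_mem_Ipre (p := p) hji.ne' hpos, rfl⟩
  rw [wS_one, hconj] at h
  obtain ⟨m, hm, hmeq⟩ := h ⟨_, rfl⟩
  obtain rfl := iotaM_injective hmeq
  have := hm i j hji
  rw [redM_apply, elemGL_apply, Matrix.one_apply_ne hji.ne'] at this
  simp at this

theorem monotone_expo_sub_of_proper {a b : Fin (N - 1) → ℤ} (hb : Monotone (expo N b))
    (h : ∀ x : GG p N,
      ((∃ g ∈ Iset p N, x = tGL p N b * g * (tGL p N b)⁻¹) ∧ x ∈ Kset p N) →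
      ((∃ g ∈ Iset p N, x = tGL p N a * g * (tGL p N a)⁻¹) ∧ x ∈ Kset p N)) :
    Monotone (expo N (b - a)) := by
  refine monotone_iff_forall_lt.2 fun j i hji => ?_
  have hbij := hb hji.le
  have hconj := powDiag_conj_elemGL (p := p) (expo N b) hji.ne'
    (c := (p : ℤ_[p]) ^ 1) (c' := (p : ℤ_[p]) ^ (expo N b i - expo N b j + 1).toNat) (by
      rw [PadicInt.coe_pow, PadicInt.coe_pow, PadicInt.coe_natCast, ← zpow_natCast,
        ← zpow_natCast, Int.toNat_of_nonneg (by lia), ← zpow_add₀ natCast_p_ne_zero]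
      simp)
  obtain ⟨⟨_, ⟨m, hm, rfl⟩, hmeq⟩, -⟩ := h _ ⟨⟨_, ⟨_, elemGL_pow_mem_Ipre hji.ne' one_ne_zero, rfl⟩,
    hconj.symm⟩, _, rfl⟩
  have hent := congrArg (fun g : GG p N => g i j) hmeq
  change _ = (powDiag p (expo N a) * iotaM p N m * (powDiag p (expo N a))⁻¹) i j at hent
  rw [powDiag_conj_apply, iotaM_apply, iotaM_apply, elemGL_apply,
    Matrix.one_apply_ne hji.ne', zero_add, Matrix.single_apply_same, PadicInt.coe_pow,
    PadicInt.coe_natCast, ← zpow_natCast, Int.toNat_of_nonneg (by lia)] at hent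
  have hnorm : ‖m i j‖ < 1 := by
    have h0 := hm i j hji
    rw [redM_apply, ← RingHom.mem_ker, PadicInt.ker_toZMod, IsLocalRing.mem_maximalIdeal,
      PadicInt.mem_nonunits] at h0
    exact h0
  have hmij : ((m i j : ℤ_[p]) : ℚ_[p]) =
      (p : ℚ_[p]) ^ (expo N b i - expo N b j + 1 - (expo N a i - expo N a j)) := by
    rw [zpow_sub₀ natCast_p_ne_zero, hent,
      mul_div_cancel_left₀ _ (zpow_ne_zero _ natCast_p_ne_zero)]
  rw [PadicInt.norm_def, hmij, Padic.norm_p_zpow, zpow_lt_one_iff_right₀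
    (by exact_mod_cast (Fact.out : p.Prime).one_lt)] at hnorm
  rw [expo_sub, Pi.sub_apply, Pi.sub_apply]
  lia

section Hecke

variable {V : Type} [AddCommGroup V] [Module (kb p) V]

theorem IsStd.apply_mul {ρ : Representation (kb p) (Gk p N) V} {v₀ : V} {a : Fin (N - 1) → ℤ}
    {f : GG p N → V} (hf : IsStd p N ρ v₀ 1 a f) (n : ℤ) (k : MM p N) {u : GG p N}
    (hu : u ∈ I1sub p N) :
    f (piSc p N n * iotaM p N k * (powDiag p (expo N a) * u)) = ρ (redM p N k) v₀ := by
  rw [hf.1.1, hf.2.1 u (mem_I1set_iff.2 hu), ← wS_one, hf.2.2.2]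

theorem hk_powDiag_eq {ρ : Representation (kb p) (Gk p 3) V} {v₀ : V} {a b : Fin 2 → ℤ}
    (ha : Monotone (expo 3 a)) (hba : Monotone (expo 3 (b - a))) {f f' : GG p 3 → V}
    (hf : IsStd p 3 ρ v₀ 1 a f) (hf' : IsStd p 3 ρ v₀ 1 b f') {R : Finset (GG p 3)}
    (hR : IsRepSet p 3 (wS p 3 1 (b - a)) R) :
    hk p 3 (wS p 3 1 (b - a)) R f = f' := by
  have hb : powDiag p (expo 3 b) = powDiag p (expo 3 a) * powDiag p (expo 3 (b - a)) := by
    rw [← powDiag_add, expo_sub, add_sub_cancel]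
  rw [wS_one] at hR ⊢
  funext x
  rw [hk]
  set e := expo 3 a
  set d := expo 3 (b - a)
  by_cases hx : ∃ (n : ℤ) (k : MM p 3) (u : GG p 3), u ∈ I1sub p 3 ∧
      x = piSc p 3 n * iotaM p 3 k * (powDiag p (expo 3 b) * u)
  · obtain ⟨n, k, u, hu, rfl⟩ := hx
    rw [hf'.apply_mul n k hu, hb]
    obtain ⟨r, ⟨hrR, hr1, hr2⟩, huniq⟩ := hR.2 u⁻¹ (mem_I1set_iff.2 (inv_mem hu))
    have hrw (s : GG p 3) : piSc p 3 n * iotaM p 3 k * (powDiag p e * powDiag p d * u) * s *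
        (powDiag p d)⁻¹ = piSc p 3 n * iotaM p 3 k *
          (powDiag p e * (powDiag p d * (u * s) * (powDiag p d)⁻¹)) := by
      group
    have hinv (s : GG p 3) : powDiag p d * (u * s) * (powDiag p d)⁻¹ =
        (powDiag p d * (s⁻¹ * u⁻¹) * (powDiag p d)⁻¹)⁻¹ := by
      group
    rw [Finset.sum_eq_single r, hrw, hf.apply_mul n k]
    · rw [hinv]
      exact inv_mem (mem_I1set_iff.1 hr2)
    · intro s hs hsr
      by_contra hne
      refine hsr (huniq s ⟨hs, ?_⟩)
      have hus : u * s ∈ I1sub p 3 := mul_mem hu (mem_I1set_iff.1 (hR.1 hs))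
      have hsu : s⁻¹ * u⁻¹ ∈ I1sub p 3 := by
        rw [← _root_.mul_inv_rev]
        exact inv_mem hus
      refine ⟨mem_I1set_iff.2 hsu, ?_⟩
      rw [hrw, hf.1.1] at hne
      obtain ⟨n', k', u', hu', heq⟩ := hf.2.2.1 _ fun h0 => hne (by rw [h0, map_zero])
      have := powDiag_conj_mem_I1sub ha hba hus (mem_I1set_iff.1 hu') heq
      rw [hinv, inv_mem_iff] at this
      exact mem_I1set_iff.2 this
    · exact fun h => absurd hrR h
  · have hzero : f' x = 0 := by
      by_contra hne
      obtain ⟨n, k, u, hu, heq⟩ := hf'.2.2.1 x hne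
      exact hx ⟨n, k, u, mem_I1set_iff.1 hu, by rw [heq, mul_assoc _ _ u]; rfl⟩
    rw [hzero]
    refine Finset.sum_eq_zero fun r hr => ?_
    by_contra hne
    obtain ⟨n, k, u, hu, heq⟩ := hf.2.2.1 _ hne
    obtain ⟨k', u', hu', heq'⟩ := exists_powDiag_mul_mul_powDiag ha hba (mem_I1set_iff.1 hu)
    refine hx ⟨n, k * k', u' * r⁻¹, mul_mem hu' (inv_mem (mem_I1set_iff.1 (hR.1 hr))), ?_⟩
    have : x = piSc p 3 n * iotaM p 3 k * (powDiag p e * u * powDiag p d) * r⁻¹ := by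
      rw [mul_inv_eq_iff_eq_mul] at heq
      rw [eq_mul_inv_iff_mul_eq, heq]
      change piSc p 3 n * iotaM p 3 k * powDiag p e * u * powDiag p d = _
      group
    rw [this, heq', hb, map_mul]
    group

end Hecke

end Iwahori

/-- if `a* ∈ S_{Id}` is proper to `a ∈ S_{Id}`, then `f_{Id,a*}` is obtained
from `f_{Id,a}` by a (finite linear combination of) Hecke operator(s). -/
theorem stmt18 (p : ℕ) [Fact p.Prime]
    {V : Type} [AddCommGroup V] [Module (kb p) V] [FiniteDimensional (kb p) V]
    (ρ : Representation (kb p) (Gk p 3) V) (hirr : IsIrred p 3 ρ)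
    (v₀ : V) (hv₀ : v₀ ≠ 0)
    (hfix : ∀ m ∈ I1pre p 3, ρ (redM p 3 m) v₀ = v₀)
    (ξ : (Fin 3 → (ZMod p)ˣ) →* (kb p)ˣ)
    (hχ : ∀ m ∈ Ipre p 3, ρ (redM p 3 m) v₀ = (ξ (diagOf p 3 m) : kb p) • v₀)
    (a astar : Fin 2 → ℤ) (ha : a ∈ Sset p 3 1) (hastar : astar ∈ Sset p 3 1)
    (hproper : ∀ x : GG p 3,
      ((∃ g ∈ Iset p 3, x = tGL p 3 astar * g * (tGL p 3 astar)⁻¹) ∧ x ∈ Kset p 3) →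
      ((∃ g ∈ Iset p 3, x = tGL p 3 a * g * (tGL p 3 a)⁻¹) ∧ x ∈ Kset p 3)) :
    ∀ f fstar : GG p 3 → V, IsStd p 3 ρ v₀ 1 a f → IsStd p 3 ρ v₀ 1 astar fstar →
      ∃ (k : ℕ) (c : Fin k → kb p) (ν : Fin k → Equiv.Perm (Fin 3))
        (b : Fin k → (Fin 2 → ℤ)),
        (∀ j : Fin k, ∀ d, ξ (d ∘ ⇑(ν j)⁻¹) = ξ d) ∧
        ∀ R : Fin k → Finset (GG p 3),
          (∀ j, IsRepSet p 3 (wS p 3 (ν j) (b j)) (R j)) →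
          (fun x => ∑ j : Fin k, c j • hk p 3 (wS p 3 (ν j) (b j)) (R j) f x) = fstar := by
  intro f fstar hf hfstar
  have hmono := monotone_expo_of_mem_Sset ha
  have hsub := monotone_expo_sub_of_proper (monotone_expo_of_mem_Sset hastar) hproper
  refine ⟨1, fun _ => 1, fun _ => 1, fun _ => astar - a, fun _ _ => rfl, fun R hR => ?_⟩
  simpa using hk_powDiag_eq hmono hsub hf hfstar (hR 0)

end IH
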